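/- For n = 2d ≥ 4 even, let F_n be the kernel of the map det : μ₂ⁿ ⋊ P_n → μ₂ sending ((ε₁,…,ε_n), τ) to ε₁ε₂⋯ε_n·sign(τ), where P_n is a Sylow 2-subgroup of the symmetric group S_n. Then the center of F_n is contained in the commutator subgroup [F_n, F_n]. -/

import Mathlib

def pairGroup {n : ℕ} (t : Equiv.Perm (Fin n)) (ht : ∀ x, t (t x) = x) :
    Subgroup (Equiv.Perm (Fin n)) where
  carrier := {σ | ∀ x, σ x = x ∨ σ x = t x}
  one_mem' := fun x => Or.inl rfl
  mul_mem' := by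
    intro a b ha hb x
    rw [Equiv.Perm.mul_apply]
    rcases hb x with h | h <;> rw [h]
    · exact ha x
    · rcases ha (t x) with h' | h' <;> rw [h']
      · exact Or.inr rfl
      · exact Or.inl (ht x)
  inv_mem' := by
    intro a ha x
    rw [Equiv.Perm.inv_eq_iff_eq, Equiv.Perm.inv_eq_iff_eq]
    rcases ha x with h | h
    · exact Or.inl h.symm
    · right
      rcases ha (t x) with h' | h'
      · have := a.injective (h.trans h'.symm)
        rw [← this]; rw [← this] at h; exact h.symm
      · rw [h', ht]

lemma pairGroup_isPGroup {n : ℕ} (t : Equiv.Perm (Fin n)) (ht : ∀ x, t (t x) = x) :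
    IsPGroup 2 (pairGroup t ht) := by
  rintro ⟨a, ha⟩
  refine ⟨1, Subtype.ext (Equiv.ext fun x => ?_)⟩
  change (a ^ (2 ^ 1)) x = x
  rw [pow_one, pow_two, Equiv.Perm.mul_apply]
  rcases ha x with h | h
  · rw [h, h]
  · rcases ha (t x) with h' | h'
    · have := a.injective (h.trans h'.symm)
      rw [h, h', ← this]
    · rw [h, h', ht]

lemma exists_pairing (n d : ℕ) (hn : n = 2 * d) :
    ∃ t : Equiv.Perm (Fin n), (∀ x, t (t x) = x) ∧ ∀ x, t x ≠ x := by
  let f : Fin n → Fin n := fun i =>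
    if h : i.1 % 2 = 0 then ⟨i.1 + 1, by omega⟩ else ⟨i.1 - 1, by omega⟩
  have hf : ∀ x, f (f x) = x := by
    intro x
    apply Fin.ext
    by_cases h : x.1 % 2 = 0
    · have h1 : (x.1 + 1) % 2 ≠ 0 := by omega
      simp only [f, dif_pos h, dif_neg h1]
      omega
    · have h1 : (x.1 - 1) % 2 = 0 := by omega
      simp only [f, dif_neg h, dif_pos h1]
      omega
  refine ⟨⟨f, f, hf, hf⟩, hf, fun x h => ?_⟩
  have h2 : (f x).1 = x.1 := congrArg Fin.val h
  simp only [f] at h2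
  split_ifs at h2 <;> simp at h2 <;> omega

lemma exists_pairing_sylow (n d : ℕ) (hn : n = 2 * d) (P : Sylow 2 (Equiv.Perm (Fin n))) :
    ∃ t : Equiv.Perm (Fin n), (∀ x, t (t x) = x) ∧ (∀ x, t x ≠ x) ∧
      ∀ x, Equiv.swap x (t x) ∈ P := by
  obtain ⟨t, ht, hne⟩ := exists_pairing n d hn
  obtain ⟨Q, hQ⟩ := (pairGroup_isPGroup t ht).exists_le_sylow
  obtain ⟨g, hg⟩ := MulAction.exists_smul_eq (Equiv.Perm (Fin n)) Q P
  refine ⟨g * t * g⁻¹, fun x => by simp [ht], fun x h => ?_, fun x => ?_⟩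
  · apply hne (g⁻¹ x)
    rw [Equiv.Perm.eq_inv_iff_eq]
    simpa using h
  · have h1 : Equiv.swap (g⁻¹ x) (t (g⁻¹ x)) ∈ Q := by
      apply hQ
      intro y
      rcases eq_or_ne y (g⁻¹ x) with h | h
      · right; rw [h, Equiv.swap_apply_left]
      · rcases eq_or_ne y (t (g⁻¹ x)) with h' | h'
        · right; rw [h', Equiv.swap_apply_right, ht]
        · left; exact Equiv.swap_apply_of_ne_of_ne h h'
    have h2 : Equiv.swap x ((g * t * g⁻¹) x) = g * Equiv.swap (g⁻¹ x) (t (g⁻¹ x)) * g⁻¹ := by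
      rw [Equiv.mul_swap_eq_swap_mul]
      simp
    rw [h2, ← hg]
    change _ ∈ ((g • Q : Sylow 2 (Equiv.Perm (Fin n))) : Subgroup (Equiv.Perm (Fin n)))
    rw [Sylow.coe_subgroup_smul]
    exact Subgroup.smul_mem_pointwise_smul (Equiv.swap (g⁻¹ x) (t (g⁻¹ x))) (MulAut.conj g)
      (Q : Subgroup (Equiv.Perm (Fin n))) h1

/-- For even `n = 2d ≥ 4`, let `F_n` be the kernel of
`det : μ₂ⁿ ⋊ P_n → μ₂`, `((ε₁,…,ε_n), τ) ↦ ε₁⋯ε_n · sign τ`, where `P_n`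
is a Sylow 2-subgroup of `S_n` and `S_n` acts on `μ₂ⁿ = (ℤˣ)ⁿ` by
permuting coordinates.  Then `Z(F_n) ≤ [F_n, F_n]`. -/
theorem stmt14 (n d : ℕ) (hd : 2 ≤ d) (hn : n = 2 * d)
    (φ : Equiv.Perm (Fin n) →* MulAut (Fin n → ℤˣ))
    (hφ : ∀ (σ : Equiv.Perm (Fin n)) (f : Fin n → ℤˣ) (i : Fin n),
      φ σ f i = f (σ⁻¹ i))
    (P : Sylow 2 (Equiv.Perm (Fin n)))
    (det : (Fin n → ℤˣ) ⋊[φ] Equiv.Perm (Fin n) →* ℤˣ)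
    (hdet : ∀ x : (Fin n → ℤˣ) ⋊[φ] Equiv.Perm (Fin n),
      det x = (∏ i, x.left i) * Equiv.Perm.sign x.right)
    (F : Subgroup ((Fin n → ℤˣ) ⋊[φ] Equiv.Perm (Fin n)))
    (hF : F = det.ker ⊓ Subgroup.comap SemidirectProduct.rightHom (P : Subgroup (Equiv.Perm (Fin n)))) :
    Subgroup.center F ≤ commutator F := by
  obtain ⟨t, ht, hne, hP⟩ := exists_pairing_sylow n d hn P
  have hFmem : ∀ x, x ∈ F ↔ (∏ i, x.left i) * Equiv.Perm.sign x.right = 1 ∧ x.right ∈ P := by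
    intro x
    rw [hF, Subgroup.mem_inf, MonoidHom.mem_ker, hdet, Subgroup.mem_comap]
    rfl
  have hφs : ∀ (σ : Equiv.Perm (Fin n)) (x : Fin n) (u : ℤˣ),
      φ σ (Pi.mulSingle x u) = Pi.mulSingle (σ x) u := by
    intro σ x u
    ext i
    rw [hφ]
    simp only [Pi.mulSingle_apply, Equiv.Perm.inv_eq_iff_eq]
  have hprod : ∀ (x : Fin n) (u : ℤˣ), ∏ i, (Pi.mulSingle x u : Fin n → ℤˣ) i = u := by
    intro x u
    simp
  have hc : ∀ x y : Fin n, ∃ c, c ≠ x ∧ c ≠ y := by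
    intro x y
    have : ∃ c ∈ (Finset.univ : Finset (Fin n)), c ∉ ({x, y} : Finset (Fin n)) := by
      apply Finset.exists_mem_notMem_of_card_lt_card
      have := Finset.card_le_two (a := x) (b := y)
      simp only [Finset.card_univ, Fintype.card_fin]
      omega
    obtain ⟨c, -, h⟩ := this
    simp only [Finset.mem_insert, Finset.mem_singleton, not_or] at h
    exact ⟨c, h⟩
  -- the even diagonal elements
  have hδ : ∀ x c : Fin n, (SemidirectProduct.inl
      (Pi.mulSingle x (-1) * Pi.mulSingle c (-1)) : (Fin n → ℤˣ) ⋊[φ] Equiv.Perm (Fin n)) ∈ F := by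
    intro x c
    rw [hFmem]
    constructor
    · simp only [SemidirectProduct.left_inl, SemidirectProduct.right_inl, Pi.mul_apply,
        Finset.prod_mul_distrib, hprod]
      simp
    · exact one_mem P
  -- lifts of the transpositions
  have hη : ∀ x : Fin n, (⟨Pi.mulSingle x (-1), Equiv.swap x (t x)⟩ :
      (Fin n → ℤˣ) ⋊[φ] Equiv.Perm (Fin n)) ∈ F := by
    intro x
    rw [hFmem]
    refine ⟨?_, hP x⟩
    simp only [hprod, Equiv.Perm.sign_swap (hne x).symm]
    simp
  have hE : ∀ x : Fin n, (SemidirectProduct.inl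
      (Pi.mulSingle x (-1) * Pi.mulSingle (t x) (-1)) :
        (Fin n → ℤˣ) ⋊[φ] Equiv.Perm (Fin n)) ∈ ⁅F, F⁆ := by
    intro x
    obtain ⟨c, hcx, hct⟩ := hc x (t x)
    have h := Subgroup.commutator_mem_commutator (hδ x c) (hη x)
    convert h using 1
    rw [commutatorElement_def, eq_mul_inv_iff_mul_eq, eq_mul_inv_iff_mul_eq]
    apply SemidirectProduct.ext
    · simp only [SemidirectProduct.mul_left, SemidirectProduct.mul_right,
        SemidirectProduct.left_inl, SemidirectProduct.right_inl, map_one, one_mul, map_mul, hφs,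
        Equiv.swap_apply_left, Equiv.swap_apply_of_ne_of_ne hcx hct, MulAut.one_apply]
      have h1 : ∀ y : Fin n, (Pi.mulSingle y (-1) : Fin n → ℤˣ) * Pi.mulSingle y (-1) = 1 := by
        intro y
        rw [← Pi.mulSingle_mul]
        simp
      generalize (Pi.mulSingle x (-1) : Fin n → ℤˣ) = X
      have h2 := h1 (t x)
      generalize (Pi.mulSingle (t x) (-1) : Fin n → ℤˣ) = Y at *
      generalize (Pi.mulSingle c (-1) : Fin n → ℤˣ) = Z
      calc X * Y * X * (Y * Z) = (Y * Y) * (X * Z * X) := by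
            simp only [mul_assoc, mul_left_comm, mul_comm]
        _ = _ := by rw [h2, one_mul]
    · simp
  have key : ∀ (k : ℕ) (ε : Fin n → ℤˣ), (∀ x, ε (t x) = ε x) →
      (Finset.univ.filter fun x => ε x ≠ 1).card = k →
      (SemidirectProduct.inl ε : (Fin n → ℤˣ) ⋊[φ] Equiv.Perm (Fin n)) ∈ ⁅F, F⁆ := by
    intro k
    induction k using Nat.strong_induction_on with
    | _ k ih =>
      intro ε hε hk
      by_cases hall : ∀ x, ε x = 1
      · have : ε = 1 := funext hall
        rw [this, map_one]
        exact one_mem _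
      · push Not at hall
        obtain ⟨x, hx⟩ := hall
        have hx1 : ε x = -1 := (Int.units_eq_one_or (ε x)).resolve_left hx
        set E : Fin n → ℤˣ := Pi.mulSingle x (-1) * Pi.mulSingle (t x) (-1) with hEdef
        have hEx : E x = -1 := by
          simp [hEdef, Pi.mulSingle_apply, (hne x).symm]
        have hEt : E (t x) = -1 := by
          simp [hEdef, Pi.mulSingle_apply, hne x]
        have hEo : ∀ y, y ≠ x → y ≠ t x → E y = 1 := by
          intro y h1 h2
          simp [hEdef, Pi.mulSingle_apply, h1, h2]
        have h1 : (SemidirectProduct.inl (ε * E) :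
            (Fin n → ℤˣ) ⋊[φ] Equiv.Perm (Fin n)) ∈ ⁅F, F⁆ := by
          refine ih _ ?_ (ε * E) ?_ rfl
          · rw [← hk]
            apply Finset.card_lt_card
            rw [Finset.ssubset_iff_of_subset]
            · exact ⟨x, by simp [hx], by simp [hx1, hEx]⟩
            · intro y
              simp only [Finset.mem_filter, Finset.mem_univ, true_and, Pi.mul_apply]
              intro hy
              by_cases h1 : y = x
              · rw [h1]; exact hx
              by_cases h2 : y = t x
              · rw [h2, hε]; exact hx
              rwa [hEo y h1 h2, mul_one] at hy
          · intro y
            rw [Pi.mul_apply, Pi.mul_apply, hε]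
            congr 1
            by_cases h1 : y = x
            · rw [h1, hEx, hEt]
            by_cases h2 : y = t x
            · rw [h2, ht, hEx, hEt]
            rw [hEo y h1 h2, hEo]
            · intro h; exact h2 (by rw [← h, ht])
            · intro h; exact h1 (t.injective h)
        have h2 := mul_mem h1 (inv_mem (hE x))
        rw [← hEdef, ← map_inv, ← map_mul, mul_inv_cancel_right] at h2
        exact h2
  rintro ⟨z, hzF⟩ hz
  rw [Subgroup.mem_center_iff] at hz
  have hz' : ∀ g ∈ F, g * z = z * g := fun g hg => congrArg Subtype.val (hz ⟨g, hg⟩)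
  have hτ : z.right = 1 := by
    ext1 x
    by_contra hx
    rw [Equiv.Perm.one_apply] at hx
    obtain ⟨c, hcx, hct⟩ := hc x (z.right x)
    have h := congrArg SemidirectProduct.left (hz' _ (hδ x c))
    simp only [SemidirectProduct.mul_left, SemidirectProduct.left_inl,
      SemidirectProduct.right_inl, map_one, MulAut.one_apply] at h
    rw [mul_comm, mul_left_cancel_iff] at h
    have h2 := congrFun h (z.right x)
    rw [hφ] at h2
    simp [Pi.mulSingle_apply, hx, hct.symm, hcx.symm] at h2
  have hinv : ∀ x, z.left (t x) = z.left x := by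
    intro x
    have h := congrArg SemidirectProduct.left (hz' _ (hη x))
    simp only [SemidirectProduct.mul_left, hτ, map_one, MulAut.one_apply] at h
    rw [mul_comm, mul_right_cancel_iff] at h
    have h2 := congrFun h x
    rw [hφ] at h2
    simpa using h2
  have hzin : z = SemidirectProduct.inl z.left := by
    apply SemidirectProduct.ext
    · simp
    · simp [hτ]
  have hzC : z ∈ ⁅F, F⁆ := by
    rw [hzin]
    exact key _ _ hinv rfl
  rw [← Subgroup.map_subtype_commutator] at hzC
  obtain ⟨w, hw, hwz⟩ := hzC
  have : w = ⟨z, hzF⟩ := Subtype.ext hwz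
  rw [← this]
  exact hw
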